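/- Let A be a ring, P a finitely generated projective left A-module, B = End_A(P)^op, F = Hom_A(P, −), G = Hom_B(FA, −), and η the unit of the adjunction F ⊣ G. For a left A-module M the following are equivalent: (a) η_M : M → GFM is an isomorphism; (b) for every A-module N, the map Hom_A(N, M) → Hom_B(FN, FM) induced by F is bijective; (c) the map Hom_A(A, M) → Hom_B(FA, FM) induced by F is an isomorphism; (d) M is a direct summand of a module in the image of G. -/

import Mathlib

open Function


section SchurFramework

variable {A : Type} [Ring A] {P : Type} [AddCommGroup P] [Module A P]

/-- `B = End_A(P)ᵒᵖ`. -/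
abbrev Bop (A : Type) [Ring A] (P : Type) [AddCommGroup P] [Module A P] : Type :=
  (Module.End A P)ᵐᵒᵖ

/-- `F M = Hom_A(P, M)` is a left `B`-module via precomposition. -/
instance instSMulBop (M : Type) [AddCommGroup M] [Module A M] :
    SMul (Bop A P) (P →ₗ[A] M) :=
  ⟨fun b φ => φ.comp b.unop⟩

@[simp] lemma smulBop_apply {M : Type} [AddCommGroup M] [Module A M]
    (b : Bop A P) (φ : P →ₗ[A] M) (p : P) : (b • φ) p = φ (b.unop p) := rfl

instance instModuleBop (M : Type) [AddCommGroup M] [Module A M] :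
    Module (Bop A P) (P →ₗ[A] M) where
  one_smul φ := LinearMap.ext fun p => rfl
  mul_smul b c φ := LinearMap.ext fun p => rfl
  smul_zero b := rfl
  smul_add b φ ψ := rfl
  add_smul b c φ := LinearMap.ext fun p => by
    simp only [smulBop_apply, MulOpposite.unop_add, LinearMap.add_apply, map_add]
  zero_smul φ := LinearMap.ext fun p => by
    simp only [smulBop_apply, MulOpposite.unop_zero, LinearMap.zero_apply, map_zero,
      LinearMap.zero_apply]

/-- Right multiplication by `a` on `F A = Hom_A(P, A)`, as a `B`-linear endomorphism.
This gives `F A` its right `A`-module structure. -/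
def rmulA (a : A) : (P →ₗ[A] A) →ₗ[Bop A P] (P →ₗ[A] A) where
  toFun f :=
    { toFun := fun p => f p * a
      map_add' := fun p q => by simp [add_mul]
      map_smul' := fun c p => by simp [smul_eq_mul, mul_assoc] }
  map_add' f g := LinearMap.ext fun p => by simp [add_mul]
  map_smul' b f := LinearMap.ext fun p => rfl

@[simp] lemma rmulA_apply (a : A) (f : P →ₗ[A] A) (p : P) : rmulA a f p = f p * a := rfl

lemma rmulA_one : (rmulA (A := A) (P := P) 1) = LinearMap.id :=
  LinearMap.ext fun f => LinearMap.ext fun p => by simp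

lemma rmulA_mul (a b : A) :
    (rmulA (A := A) (P := P) (a * b)) = (rmulA b).comp (rmulA a) :=
  LinearMap.ext fun f => LinearMap.ext fun p => by simp [mul_assoc]

lemma rmulA_add (a b : A) :
    (rmulA (A := A) (P := P) (a + b)) = rmulA a + rmulA b :=
  LinearMap.ext fun f => LinearMap.ext fun p => by simp [mul_add]

lemma rmulA_zero : (rmulA (A := A) (P := P) 0) = 0 :=
  LinearMap.ext fun f => LinearMap.ext fun p => by simp

/-- `G N = Hom_B(FA, N)` is a left `A`-module, via the right `A`-module structure of `FA`. -/
instance instSMulGA (N : Type) [AddCommGroup N] [Module (Bop A P) N] :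
    SMul A ((P →ₗ[A] A) →ₗ[Bop A P] N) :=
  ⟨fun a g => g.comp (rmulA a)⟩

@[simp] lemma smulGA_apply {N : Type} [AddCommGroup N] [Module (Bop A P) N]
    (a : A) (g : (P →ₗ[A] A) →ₗ[Bop A P] N) (f : P →ₗ[A] A) :
    (a • g) f = g (rmulA a f) := rfl

instance instModuleGA (N : Type) [AddCommGroup N] [Module (Bop A P) N] :
    Module A ((P →ₗ[A] A) →ₗ[Bop A P] N) where
  one_smul g := show g.comp (rmulA 1) = g by rw [rmulA_one, LinearMap.comp_id]
  mul_smul a b g := show g.comp (rmulA (a * b)) = (g.comp (rmulA b)).comp (rmulA a) by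
    rw [rmulA_mul, LinearMap.comp_assoc]
  smul_zero a := LinearMap.zero_comp _
  smul_add a g h := LinearMap.add_comp _ _ _
  add_smul a b g := show g.comp (rmulA (a + b)) = g.comp (rmulA a) + g.comp (rmulA b) by
    rw [rmulA_add, LinearMap.comp_add]
  zero_smul g := show g.comp (rmulA 0) = 0 by rw [rmulA_zero, LinearMap.comp_zero]

/-- For `f ∈ Hom_A(P, A)` and `x ∈ X`, the map `p ↦ f p • x`, an element of `F X`. -/
def starMap {X : Type} [AddCommGroup X] [Module A X] (f : P →ₗ[A] A) (x : X) :
    P →ₗ[A] X where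
  toFun p := f p • x
  map_add' p q := by simp [add_smul]
  map_smul' a p := by simp [smul_eq_mul, mul_smul]

@[simp] lemma starMap_apply {X : Type} [AddCommGroup X] [Module A X]
    (f : P →ₗ[A] A) (x : X) (p : P) : starMap f x p = f p • x := rfl

lemma starMap_addl {X : Type} [AddCommGroup X] [Module A X] (f g : P →ₗ[A] A) (x : X) :
    starMap (f + g) x = starMap f x + starMap g x :=
  LinearMap.ext fun p => by simp [add_smul]

lemma starMap_smulB {X : Type} [AddCommGroup X] [Module A X] (b : Bop A P)
    (f : P →ₗ[A] A) (x : X) : starMap (b • f) x = b • starMap f x :=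
  LinearMap.ext fun p => rfl

lemma starMap_smulA {X : Type} [AddCommGroup X] [Module A X] (a : A)
    (f : P →ₗ[A] A) (x : X) : starMap f (a • x) = starMap (rmulA a f) x :=
  LinearMap.ext fun p => by simp [mul_smul]

/-- The adjunction bijection `Φ : Hom_B(F X, M) → Hom_A(X, G M)` of `F ⊣ G`. -/
def PhiAdj {X : Type} [AddCommGroup X] [Module A X]
    {M : Type} [AddCommGroup M] [Module (Bop A P) M]
    (k : (P →ₗ[A] X) →ₗ[Bop A P] M) :
    X →ₗ[A] ((P →ₗ[A] A) →ₗ[Bop A P] M) where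
  toFun x :=
    { toFun := fun f => k (starMap f x)
      map_add' := fun f g => by
        show k (starMap (f + g) x) = k (starMap f x) + k (starMap g x)
        rw [starMap_addl, map_add]
      map_smul' := fun b f => by
        show k (starMap (b • f) x) = b • k (starMap f x)
        rw [starMap_smulB, map_smul] }
  map_add' x y := LinearMap.ext fun f => by
    have : starMap f (x + y) = starMap f x + starMap f y :=
      LinearMap.ext fun p => by simp [smul_add]
    simp [this]
  map_smul' a x := LinearMap.ext fun f => by
    simp [starMap_smulA]

/-- `G` on morphisms: post-composition. -/
def Gmap {M N : Type} [AddCommGroup M] [Module (Bop A P) M]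
    [AddCommGroup N] [Module (Bop A P) N] (g : M →ₗ[Bop A P] N) :
    ((P →ₗ[A] A) →ₗ[Bop A P] M) →ₗ[A] ((P →ₗ[A] A) →ₗ[Bop A P] N) where
  toFun φ := g.comp φ
  map_add' φ ψ := LinearMap.ext fun f => by simp
  map_smul' a φ := LinearMap.ext fun f => rfl


/-- `F` on morphisms: post-composition with `h`. -/
def Fmap {M N : Type} [AddCommGroup M] [Module A M] [AddCommGroup N] [Module A N]
    (h : M →ₗ[A] N) : (P →ₗ[A] M) →ₗ[Bop A P] (P →ₗ[A] N) where
  toFun φ := h.comp φ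
  map_add' φ ψ := LinearMap.ext fun p => by simp
  map_smul' b φ := LinearMap.ext fun p => rfl

/-- The unit `η_X : X → G F X` of the adjunction `F ⊣ G`;
explicitly `η x f p = f p • x`. -/
def etaL (X : Type) [AddCommGroup X] [Module A X] :
    X →ₗ[A] ((P →ₗ[A] A) →ₗ[Bop A P] (P →ₗ[A] X)) :=
  PhiAdj (LinearMap.id : (P →ₗ[A] X) →ₗ[Bop A P] (P →ₗ[A] X))

end SchurFramework

section SchurFramework

variable {A : Type} [Ring A] {P : Type} [AddCommGroup P] [Module A P]

/-- The dual basis lemma for finitely generated projective modules. -/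
lemma exists_dualBasis (A P : Type) [Ring A] [AddCommGroup P] [Module A P]
    [Module.Finite A P] [Module.Projective A P] :
    ∃ (n : ℕ) (p : Fin n → P) (f : Fin n → P →ₗ[A] A), ∀ q, ∑ i, f i q • p i = q := by
  obtain ⟨n, f, g, -, -, hfg⟩ := Module.Finite.exists_comp_eq_id_of_projective A P
  refine ⟨n, fun i => f (Pi.single i 1), fun i => (LinearMap.proj i).comp g, fun q => ?_⟩
  have hq : f (g q) = q := LinearMap.congr_fun hfg q
  conv_rhs => rw [← hq, pi_eq_sum_univ' (g q), map_sum]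
  refine Finset.sum_congr rfl fun i _ => ?_
  rw [← map_smul]
  congr 1

lemma comp_starMap {X Y : Type} [AddCommGroup X] [Module A X] [AddCommGroup Y]
    [Module A Y] (h : X →ₗ[A] Y) (f : P →ₗ[A] A) (x : X) :
    h.comp (starMap f x) = starMap f (h x) :=
  LinearMap.ext fun p => by simp

lemma PhiAdj_Fmap {X Y : Type} [AddCommGroup X] [Module A X] [AddCommGroup Y]
    [Module A Y] (h : X →ₗ[A] Y) :
    PhiAdj (Fmap (P := P) h) = (etaL Y).comp h :=
  LinearMap.ext fun x => LinearMap.ext fun f => comp_starMap h f x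

lemma etaL_naturality {X Y : Type} [AddCommGroup X] [Module A X] [AddCommGroup Y]
    [Module A Y] (h : X →ₗ[A] Y) (x : X) :
    Gmap (Fmap (P := P) h) (etaL X x) = etaL Y (h x) :=
  LinearMap.ext fun f => comp_starMap h f x

lemma sum_starMap_dualBasis {n : ℕ} {p : Fin n → P} {f : Fin n → P →ₗ[A] A}
    (hpf : ∀ q, ∑ i, f i q • p i = q) {X : Type} [AddCommGroup X] [Module A X]
    (φ : P →ₗ[A] X) : ∑ i, starMap (f i) (φ (p i)) = φ := by
  ext q
  conv_rhs => rw [← hpf q]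
  simp

/-- The inverse of the adjunction bijection `PhiAdj`, in terms of a dual basis of `P`. -/
def PhiAdjInv {n : ℕ} {p : Fin n → P} {f : Fin n → P →ₗ[A] A}
    (hpf : ∀ q, ∑ i, f i q • p i = q) {X : Type} [AddCommGroup X] [Module A X]
    {N : Type} [AddCommGroup N] [Module (Bop A P) N]
    (g : X →ₗ[A] ((P →ₗ[A] A) →ₗ[Bop A P] N)) : (P →ₗ[A] X) →ₗ[Bop A P] N where
  toFun φ := ∑ i, g (φ (p i)) (f i)
  map_add' φ ψ := by simp [Finset.sum_add_distrib]
  map_smul' b φ := by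
    have h1 (i : Fin n) : g ((b • φ) (p i)) (f i) =
        ∑ j, g (φ (p j)) (rmulA (f j (b.unop (p i))) (f i)) := by
      rw [smulBop_apply]
      conv_lhs => rw [← hpf (b.unop (p i))]
      simp [LinearMap.sum_apply]
    have h2 (j : Fin n) : ∑ i, rmulA (f j (b.unop (p i))) (f i) = b • f j :=
      sum_starMap_dualBasis hpf (b • f j)
    simp only [h1, RingHom.id_apply, Finset.smul_sum]
    rw [Finset.sum_comm]
    refine Finset.sum_congr rfl fun j _ => ?_
    rw [← map_sum, h2, map_smul]

lemma PhiAdj_bijective [Module.Finite A P] [Module.Projective A P]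
    {X : Type} [AddCommGroup X] [Module A X] {N : Type} [AddCommGroup N] [Module (Bop A P) N] :
    Bijective (PhiAdj : ((P →ₗ[A] X) →ₗ[Bop A P] N) → _) := by
  obtain ⟨n, p, f, hpf⟩ := exists_dualBasis A P
  refine bijective_iff_has_inverse.mpr ⟨PhiAdjInv hpf, fun k => LinearMap.ext fun φ => ?_,
    fun g => LinearMap.ext fun x => LinearMap.ext fun e => ?_⟩
  · change ∑ i, k (starMap (f i) (φ (p i))) = k φ
    rw [← map_sum, sum_starMap_dualBasis hpf]
  · change ∑ i, g (e (p i) • x) (f i) = g x e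
    simp only [map_smul, smulGA_apply]
    rw [← map_sum]
    exact congrArg (g x) (sum_starMap_dualBasis hpf e)

lemma etaL_bijective_of_hom [Module.Finite A P] [Module.Projective A P]
    (N : Type) [AddCommGroup N] [Module (Bop A P) N] :
    Bijective (etaL (A := A) (P := P) ((P →ₗ[A] A) →ₗ[Bop A P] N)) := by
  obtain ⟨ε, hε⟩ := PhiAdj_bijective.2
    (LinearMap.id : ((P →ₗ[A] A) →ₗ[Bop A P] N) →ₗ[A] ((P →ₗ[A] A) →ₗ[Bop A P] N))
  have hε' (g : (P →ₗ[A] A) →ₗ[Bop A P] N) (f : P →ₗ[A] A) : ε (starMap f g) = g f :=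
    LinearMap.congr_fun (LinearMap.congr_fun hε g) f
  have hinj : Injective ε := by
    rw [injective_iff_map_eq_zero]
    intro φ hφ
    ext p f
    have hb : starMap f (φ p) = MulOpposite.op (starMap f p : Module.End A P) • φ :=
      (comp_starMap φ f p).symm
    rw [← hε', hb, map_smul, hφ, smul_zero]
    rfl
  have hleft : LeftInverse (Gmap ε) (etaL (A := A) (P := P) ((P →ₗ[A] A) →ₗ[Bop A P] N)) :=
    fun g => LinearMap.ext fun f => hε' g f
  refine ⟨hleft.injective, (hleft.rightInverse_of_injective fun φ ψ h => ?_).surjective⟩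
  exact LinearMap.ext fun f => hinj (LinearMap.congr_fun h f)

lemma etaL_bijective_of_retract {X Y : Type} [AddCommGroup X] [Module A X] [AddCommGroup Y]
    [Module A Y] (i : X →ₗ[A] Y) (r : Y →ₗ[A] X) (hri : r.comp i = LinearMap.id)
    (hY : Bijective (etaL (A := A) (P := P) Y)) : Bijective (etaL (A := A) (P := P) X) := by
  have hri' : LeftInverse r i := LinearMap.congr_fun hri
  constructor
  · intro x y hxy
    apply hri'.injective
    apply hY.1
    rw [← etaL_naturality, ← etaL_naturality, hxy]
  · intro g
    obtain ⟨y, hy⟩ := hY.2 (Gmap (Fmap i) g)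
    refine ⟨r y, ?_⟩
    rw [← etaL_naturality, hy]
    ext f p
    exact hri' (g f p)

end SchurFramework

/-- For a left `A`-module `M` (with `P` finitely generated projective,
`B = End_A(P)ᵒᵖ`, `F = Hom_A(P,−)`, `G = Hom_B(FA,−)`, `η` the unit of `F ⊣ G`),
the following are equivalent:
(a) `η_M : M → GFM` is an isomorphism;
(b) for every `A`-module `N`, the map `Hom_A(N, M) → Hom_B(FN, FM)` induced by `F` is bijective;
(c) the map `Hom_A(A, M) → Hom_B(FA, FM)` induced by `F` is an isomorphism;
(d) `M` is a direct summand of a module in the image of `G`. -/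
theorem unit_iso_tfae
    (A : Type) [Ring A] (P : Type) [AddCommGroup P] [Module A P]
    [Module.Finite A P] [Module.Projective A P]
    (M : Type) [AddCommGroup M] [Module A M] :
    (Function.Bijective (etaL (A := A) (P := P) M) ↔
      ∀ (N : Type) [AddCommGroup N] [Module A N],
        Function.Bijective (fun h : N →ₗ[A] M => Fmap (A := A) (P := P) h)) ∧
    (Function.Bijective (etaL (A := A) (P := P) M) ↔
      Function.Bijective (fun h : A →ₗ[A] M => Fmap (A := A) (P := P) h)) ∧
    (Function.Bijective (etaL (A := A) (P := P) M) ↔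
      ∃ (N : ModuleCat (Bop A P)) (i : M →ₗ[A] ((P →ₗ[A] A) →ₗ[Bop A P] N))
        (r : ((P →ₗ[A] A) →ₗ[Bop A P] N) →ₗ[A] M), r.comp i = LinearMap.id) := by
  have hcomp (N : Type) [AddCommGroup N] [Module A N] :
      Bijective (fun h : N →ₗ[A] M => Fmap (A := A) (P := P) h) ↔
        Bijective (fun h : N →ₗ[A] M => (etaL (A := A) (P := P) M).comp h) := by
    rw [← PhiAdj_bijective.of_comp_iff']
    exact iff_of_eq (congrArg Bijective (funext PhiAdj_Fmap))
  have hab (h : Bijective (etaL (A := A) (P := P) M)) (N : Type) [AddCommGroup N]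
      [Module A N] : Bijective (fun h : N →ₗ[A] M => Fmap (A := A) (P := P) h) := by
    rw [hcomp]
    refine ⟨fun u v huv => LinearMap.ext fun x => h.1 (LinearMap.congr_fun huv x), fun g => ?_⟩
    refine ⟨(LinearEquiv.ofBijective _ h).symm.toLinearMap.comp g, LinearMap.ext fun x => ?_⟩
    exact (LinearEquiv.ofBijective _ h).apply_symm_apply (g x)
  have hca (h : Bijective (fun h : A →ₗ[A] M => Fmap (A := A) (P := P) h)) :
      Bijective (etaL (A := A) (P := P) M) := by
    rw [hcomp] at h
    constructor
    · intro x y hxy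
      have := @h.1 (LinearMap.toSpanSingleton A M x) (LinearMap.toSpanSingleton A M y)
        (LinearMap.ext_ring (by simpa using hxy))
      simpa using LinearMap.congr_fun this 1
    · intro g
      obtain ⟨u, hu⟩ := h.2 (LinearMap.toSpanSingleton A _ g)
      exact ⟨u 1, by simpa using LinearMap.congr_fun hu 1⟩
  refine ⟨⟨fun h N _ _ => hab h N, fun h => hca (h A)⟩, ⟨fun h => hab h A, hca⟩, fun h => ?_, ?_⟩
  · exact ⟨ModuleCat.of _ (P →ₗ[A] M), etaL M, (LinearEquiv.ofBijective _ h).symm.toLinearMap,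
      LinearMap.ext (LinearEquiv.ofBijective _ h).symm_apply_apply⟩
  · rintro ⟨N, i, r, hri⟩
    exact etaL_bijective_of_retract i r hri (etaL_bijective_of_hom N)
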